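/- arXiv:2411.07054 — 4 statements merged into one kernel-verified Lean document; each statement's English description precedes it below -/
import Mathlib

section
/- For every (r_i) ∈ 𝕽 and all constants c_1, c_2 > 0 there exist a sequence (r̃_i) ∈ 𝕽 and a constant C ≥ 0 such that N_{(r_i)}(c_1·ρ) ≤ c_2·N_{(r̃_i)}(ρ) + C for all ρ > 0. -/
open scoped BigOperators

/-- `log₊ x = max (log x) 0`. -/
noncomputable def logPlus (x : ℝ) : ℝ := max (Real.log x) 0

/-- The associated function `M(ρ) = sup_p log₊ (ρ^p / M_p)`. -/
noncomputable def assocM (Mp : ℕ → ℝ) (ρ : ℝ) : ℝ :=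
  ⨆ p : ℕ, logPlus (ρ ^ p / Mp p)

/-- `N_{(r_i)}(ρ) = sup_p log₊ (ρ^p / (M_p · Π_{i=1}^p r_i))`
(the sequence `(r_i)_{i≥1}` is indexed here by `ℕ`, `r 0 = r_1`, etc.). -/
noncomputable def assocN (Mp : ℕ → ℝ) (r : ℕ → ℝ) (ρ : ℝ) : ℝ :=
  ⨆ p : ℕ, logPlus (ρ ^ p / (Mp p * ∏ i ∈ Finset.range p, r i))

/-- `(r_i) ∈ 𝕽`: positive, monotonically increasing, tending to infinity. -/
def InRcal (r : ℕ → ℝ) : Prop :=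
  (∀ i, 0 < r i) ∧ Monotone r ∧ Filter.Tendsto r Filter.atTop Filter.atTop

/-- Condition (M.1): logarithmic convexity. -/
def CondM1 (Mp : ℕ → ℝ) : Prop :=
  ∀ p : ℕ, (Mp (p + 1)) ^ 2 ≤ Mp p * Mp (p + 2)

/-- Condition (M.2) with constants `c0, H`. -/
def CondM2 (Mp : ℕ → ℝ) (c0 H : ℝ) : Prop :=
  ∀ p q : ℕ, Mp (p + q) ≤ c0 * H ^ (p + q) * Mp p * Mp q

/-- Condition (M.2). -/
def CondM2' (Mp : ℕ → ℝ) : Prop :=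
  ∃ c0 H : ℝ, 1 ≤ c0 ∧ 1 ≤ H ∧ CondM2 Mp c0 H

/-- Condition (M.3): `Σ_{j=p+1}^∞ M_{j-1}/M_j ≤ c0 · p · M_p / M_{p+1}`. -/
def CondM3 (Mp : ℕ → ℝ) : Prop :=
  ∃ c0 : ℝ, 1 ≤ c0 ∧ ∀ p : ℕ, 1 ≤ p →
    ∑' n : ℕ, Mp (p + n) / Mp (p + n + 1) ≤ c0 * p * Mp p / Mp (p + 1)

theorem logPlus_mono {x y : ℝ} (hx : 0 < x) (hxy : x ≤ y) : logPlus x ≤ logPlus y :=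
  max_le_max (Real.log_le_log hx hxy) le_rfl

theorem logPlus_nonneg (x : ℝ) : 0 ≤ logPlus x := le_max_right _ _

theorem CondM1.mul_le_succ {Mp : ℕ → ℝ} (hMpos : ∀ p, 0 < Mp p) (hM0 : Mp 0 = 1)
    (hM1 : CondM1 Mp) (p : ℕ) : Mp 1 * Mp p ≤ Mp (p + 1) := by
  induction p with
  | zero => simp [hM0]
  | succ k ih =>
    have h := hM1 k
    have h1 := mul_le_mul_of_nonneg_right ih (hMpos (k + 1)).le
    refine le_of_mul_le_mul_left ?_ (hMpos k)
    nlinarith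

theorem assocN_bddAbove {Mp : ℕ → ℝ} (hMpos : ∀ p, 0 < Mp p) (hM0 : Mp 0 = 1)
    (hM1 : CondM1 Mp) {r : ℕ → ℝ} (hr : InRcal r) {ρ : ℝ} (hρ : 0 < ρ) :
    BddAbove (Set.range fun p : ℕ =>
      logPlus (ρ ^ p / (Mp p * ∏ i ∈ Finset.range p, r i))) := by
  obtain ⟨hpos, -, htop⟩ := hr
  obtain ⟨N, hN⟩ := Filter.eventually_atTop.1 (htop.eventually_ge_atTop (ρ / Mp 1))
  have hprod (p : ℕ) : 0 < ∏ i ∈ Finset.range p, r i := Finset.prod_pos fun i _ => hpos i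
  have hden (p : ℕ) : 0 < Mp p * ∏ i ∈ Finset.range p, r i := mul_pos (hMpos p) (hprod p)
  apply Filter.IsBoundedUnder.bddAbove_range
  refine Filter.isBoundedUnder_of_eventually_le
    (a := logPlus (ρ ^ N / (Mp N * ∏ i ∈ Finset.range N, r i))) ?_
  refine Filter.eventually_atTop.2 ⟨N, fun p hp => ?_⟩
  refine logPlus_mono (div_pos (pow_pos hρ p) (hden p)) ?_
  induction p, hp using Nat.le_induction with
  | base => exact le_rfl
  | succ p hp ih =>
    refine le_trans ?_ ih
    rw [div_le_div_iff₀ (hden _) (hden _), Finset.prod_range_succ, pow_succ]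
    have h1 : ρ ≤ r p * Mp 1 := (div_le_iff₀ (hMpos 1)).1 (hN p hp)
    have h2 : ρ * Mp p ≤ Mp (p + 1) * r p := by
      have h3 := mul_le_mul_of_nonneg_right h1 (hMpos p).le
      have h4 := mul_le_mul_of_nonneg_right (hM1.mul_le_succ hMpos hM0 p) (hpos p).le
      linarith
    have h5 := mul_le_mul_of_nonneg_left h2 (mul_pos (pow_pos hρ p) (hprod p)).le
    linarith

theorem CondM2'.exists_le_pow {Mp : ℕ → ℝ} (hMpos : ∀ p, 0 < Mp p) (hM0 : Mp 0 = 1)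
    (hM2 : CondM2' Mp) (n : ℕ) :
    ∃ A B : ℝ, 1 ≤ A ∧ 1 ≤ B ∧ ∀ p : ℕ, Mp (n * p) ≤ A * B ^ (n * p) * Mp p ^ n := by
  obtain ⟨c0, H, hc0, hH, h⟩ := hM2
  induction n with
  | zero => exact ⟨1, 1, le_rfl, le_rfl, by simp [hM0]⟩
  | succ n ih =>
    obtain ⟨A, B, hA, hB, hAB⟩ := ih
    have hH0 : 0 < H := one_pos.trans_le hH
    have hB0 : 0 < B := one_pos.trans_le hB
    refine ⟨c0 * A, H * B, one_le_mul_of_one_le_of_one_le hc0 hA,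
      one_le_mul_of_one_le_of_one_le hH hB, fun p => ?_⟩
    have hp := hMpos p
    calc Mp ((n + 1) * p) = Mp (n * p + p) := by rw [add_one_mul]
      _ ≤ c0 * H ^ (n * p + p) * Mp (n * p) * Mp p := h _ _
      _ ≤ c0 * H ^ (n * p + p) * (A * B ^ (n * p) * Mp p ^ n) * Mp p := by
        gcongr; exact hAB p
      _ ≤ c0 * H ^ (n * p + p) * (A * B ^ (n * p + p) * Mp p ^ n) * Mp p := by
        gcongr
        omega
      _ = c0 * A * (H * B) ^ ((n + 1) * p) * Mp p ^ (n + 1) := by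
        rw [add_one_mul, mul_pow]; ring

theorem prod_range_mul_div {n : ℕ} (hn : 0 < n) (f : ℕ → ℝ) (p : ℕ) :
    ∏ i ∈ Finset.range (n * p), f (i / n) = (∏ i ∈ Finset.range p, f i) ^ n := by
  induction p with
  | zero => simp
  | succ p ih =>
    rw [Nat.mul_succ, Finset.prod_range_add, ih, Finset.prod_range_succ, mul_pow]
    congr 1
    rw [Finset.prod_congr rfl (g := fun _ => f p), Finset.prod_const, Finset.card_range]
    intro i hi
    rw [Nat.mul_add_div hn, Nat.div_eq_of_lt (Finset.mem_range.1 hi), add_zero]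

theorem InRcal.comp_div {r : ℕ → ℝ} (hr : InRcal r) {n : ℕ} (hn : 0 < n) {K : ℝ}
    (hK : 0 < K) : InRcal fun i => r (i / n) / K := by
  obtain ⟨hpos, hmono, htop⟩ := hr
  refine ⟨fun i => div_pos (hpos _) hK, fun i j hij => ?_, ?_⟩
  · exact div_le_div_of_nonneg_right (hmono (Nat.div_le_div_right hij)) hK.le
  · exact (htop.comp (Nat.tendsto_div_const_atTop hn.ne')).atTop_div_const hK

theorem stmt3 (Mp : ℕ → ℝ) (hMpos : ∀ p, 0 < Mp p) (hM0 : Mp 0 = 1)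
    (hM1 : CondM1 Mp) (hM2 : CondM2' Mp)
    (r : ℕ → ℝ) (hr : InRcal r) (c1 c2 : ℝ) (hc1 : 0 < c1) (hc2 : 0 < c2) :
    ∃ rt : ℕ → ℝ, InRcal rt ∧ ∃ C : ℝ, 0 ≤ C ∧
      ∀ ρ : ℝ, 0 < ρ → assocN Mp r (c1 * ρ) ≤ c2 * assocN Mp rt ρ + C := by
  obtain ⟨n, hn⟩ := exists_nat_gt (1 / c2)
  have hnR : (0 : ℝ) < n := (one_div_pos.2 hc2).trans hn
  have hn0 : 0 < n := Nat.cast_pos.1 hnR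
  have hnc : 1 ≤ c2 * n := by
    have := (div_lt_iff₀ hc2).1 hn
    linarith
  obtain ⟨A, B, hA, hB, hAB⟩ := hM2.exists_le_pow hMpos hM0 n
  have hA0 : 0 < A := one_pos.trans_le hA
  have hB0 : 0 < B := one_pos.trans_le hB
  have hrt : InRcal fun i => r (i / n) / (c1 * B) := hr.comp_div hn0 (mul_pos hc1 hB0)
  have hC : 0 ≤ Real.log A / n := div_nonneg (Real.log_nonneg hA) hnR.le
  refine ⟨_, hrt, Real.log A / n, hC, fun ρ hρ => ?_⟩
  have hS : 0 ≤ assocN Mp (fun i => r (i / n) / (c1 * B)) ρ :=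
    Real.iSup_nonneg fun p => logPlus_nonneg _
  have hle (q : ℕ) := le_ciSup (assocN_bddAbove hMpos hM0 hM1 hrt hρ) q
  refine ciSup_le fun p => max_le ?_ (by positivity)
  set S := assocN Mp (fun i => r (i / n) / (c1 * B)) ρ with hSdef
  have hR : 0 < ∏ i ∈ Finset.range p, r i := Finset.prod_pos fun i _ => hr.1 i
  have hp := hMpos p
  have hnp := hMpos (n * p)
  set R := ∏ i ∈ Finset.range p, r i
  have hprod : ∏ i ∈ Finset.range (n * p), r (i / n) / (c1 * B)
      = R ^ n / (c1 * B) ^ (n * p) := by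
    rw [Finset.prod_div_distrib, prod_range_mul_div hn0, Finset.prod_const, Finset.card_range]
  have hkey : ((c1 * ρ) ^ p / (Mp p * R)) ^ n
      ≤ A * (ρ ^ (n * p) / (Mp (n * p) * (R ^ n / (c1 * B) ^ (n * p)))) := by
    calc ((c1 * ρ) ^ p / (Mp p * R)) ^ n = (c1 * ρ) ^ (n * p) / (Mp p ^ n * R ^ n) := by
          rw [div_pow, mul_pow (Mp p), ← pow_mul, mul_comm p n]
      _ ≤ A * ((c1 * B * ρ) ^ (n * p) / (Mp (n * p) * R ^ n)) := by
        rw [← mul_div_assoc, div_le_div_iff₀ (by positivity) (by positivity)]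
        calc (c1 * ρ) ^ (n * p) * (Mp (n * p) * R ^ n)
            ≤ (c1 * ρ) ^ (n * p) * ((A * B ^ (n * p) * Mp p ^ n) * R ^ n) := by
              gcongr; exact hAB p
          _ = A * (c1 * B * ρ) ^ (n * p) * (Mp p ^ n * R ^ n) := by
              simp only [mul_pow]; ring
      _ = _ := by
        rw [mul_pow (c1 * B)]; field_simp
  have hlog := Real.log_le_log (by positivity) hkey
  rw [Real.log_pow, Real.log_mul hA0.ne' (by positivity)] at hlog
  have hq := (le_max_left _ _).trans (hle (n * p))
  rw [hprod] at hq
  change _ ≤ S at hq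
  have h1 : Real.log ((c1 * ρ) ^ p / (Mp p * R)) ≤ (Real.log A + S) / n := by
    rw [le_div_iff₀ hnR]; linarith
  have h2 : S / n ≤ c2 * S := by
    rw [div_le_iff₀ hnR]; nlinarith
  rw [add_div] at h1
  linarith
end

section
/- Let φ : ℝ → ℂ be a smooth function with compact support such that for every h > 0, sup_{t∈ℝ, p∈ℕ} |φ^{(p)}(t)|/(h^p M_p) < ∞. Then for every k > 0 there exists C > 0 such that |∫_ℝ e^{i t/ε} φ(t) dt| ≤ C·e^{−M(k/ε)} for all ε ∈ (0,1). In particular, the net of complex numbers (∫_ℝ e^{i t/ε} φ(t) dt)_{ε∈(0,1)} is (M_p)-negligible, i.e., it is O(e^{−M(k/ε)}) for every k > 0. -/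
open scoped BigOperators

open MeasureTheory FourierTransform

lemma integral_exp_mul_eq_fourier (φ : ℝ → ℂ) (ε : ℝ) :
    ∫ t : ℝ, Complex.exp (Complex.I * (t : ℂ) / (ε : ℂ)) * φ t =
      𝓕 φ (-(2 * Real.pi * ε)⁻¹) := by
  rw [Real.fourier_real_eq_integral_exp_smul]
  refine integral_congr_ae (Filter.Eventually.of_forall fun t => ?_)
  simp only [smul_eq_mul]
  congr 2
  have hpi : (Real.pi : ℂ) ≠ 0 := by exact_mod_cast Real.pi_ne_zero
  push_cast
  field_simp

lemma tsupport_iteratedDeriv_subset_tsupport (φ : ℝ → ℂ) (n : ℕ) :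
    tsupport (iteratedDeriv n φ) ⊆ tsupport φ := by
  refine (closure_mono fun t ht => ?_).trans (tsupport_iteratedFDeriv_subset (𝕜 := ℝ) n)
  rw [Function.mem_support, ← norm_ne_zero_iff] at ht ⊢
  rwa [norm_iteratedFDeriv_eq_norm_iteratedDeriv]

lemma integrable_iteratedDeriv_of_hasCompactSupport {φ : ℝ → ℂ}
    (hφ : ContDiff ℝ (⊤ : ℕ∞) φ) (hφc : HasCompactSupport φ) (n : ℕ) :
    Integrable (iteratedDeriv n φ) :=
  (hφ.continuous_iteratedDeriv n (by exact_mod_cast le_top)).integrable_of_hasCompactSupport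
    (hφc.of_isClosed_subset isClosed_closure (tsupport_iteratedDeriv_subset_tsupport φ n))

/-- Repeated integration by parts in an oscillatory integral. -/
lemma inv_pow_mul_norm_integral_exp_mul_le {φ : ℝ → ℂ}
    (hφ : ContDiff ℝ (⊤ : ℕ∞) φ) (hφc : HasCompactSupport φ) {A : ℝ} {n : ℕ}
    (hA : ∀ t, ‖iteratedDeriv n φ t‖ ≤ A) {ε : ℝ} (hε : 0 < ε) :
    ε⁻¹ ^ n * ‖∫ t : ℝ, Complex.exp (Complex.I * (t : ℂ) / (ε : ℂ)) * φ t‖ ≤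
      A * volume.real (tsupport φ) := by
  have hF := congrFun (Real.fourier_iteratedDeriv (N := ⊤) (n := n) hφ
    (fun m _ => integrable_iteratedDeriv_of_hasCompactSupport hφ hφc m) le_top)
    (-(2 * Real.pi * ε)⁻¹)
  have hnorm : ‖(2 * Real.pi * Complex.I * ((-(2 * Real.pi * ε)⁻¹ : ℝ) : ℂ))‖ = ε⁻¹ := by
    simp only [norm_mul, Complex.norm_I, Complex.norm_real, norm_neg, norm_inv,
      Complex.norm_ofNat, Real.norm_ofNat, Real.norm_of_nonneg Real.pi_pos.le,
      Real.norm_of_nonneg hε.le]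
    field_simp
  have hF' := congrArg norm hF
  rw [norm_smul, norm_pow, hnorm] at hF'
  rw [integral_exp_mul_eq_fourier, ← hF']
  calc ‖𝓕 (iteratedDeriv n φ) (-(2 * Real.pi * ε)⁻¹)‖
      ≤ ∫ t, ‖iteratedDeriv n φ t‖ :=
        VectorFourier.norm_fourierIntegral_le_integral_norm _ _ _ _ _
    _ = ∫ t in tsupport φ, ‖iteratedDeriv n φ t‖ := by
        refine (setIntegral_eq_integral_of_forall_compl_eq_zero fun t ht => ?_).symm
        rw [image_eq_zero_of_notMem_tsupport
          fun h => ht (tsupport_iteratedDeriv_subset_tsupport φ n h), norm_zero]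
    _ ≤ ‖∫ t in tsupport φ, ‖iteratedDeriv n φ t‖‖ := Real.le_norm_self _
    _ ≤ A * volume.real (tsupport φ) :=
        norm_setIntegral_le_of_norm_le_const hφc.isCompact.measure_lt_top
          fun t _ => by simpa using hA t

/-- A quantity dominated by `D * M_p / ρ ^ p` for all `p` is dominated by `D * exp (-M(ρ))`. -/
lemma le_mul_exp_neg_assocM {Mp : ℕ → ℝ} (hMpos : ∀ p, 0 < Mp p) (hM0 : Mp 0 = 1)
    {ρ x D : ℝ} (hρ : 0 < ρ) (hx : 0 ≤ x) (hD : 0 ≤ D)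
    (h : ∀ p, ρ ^ p / Mp p * x ≤ D) :
    x ≤ D * Real.exp (-assocM Mp ρ) := by
  rcases hx.eq_or_lt with rfl | hx
  · positivity
  have hle : ∀ p, ρ ^ p / Mp p ≤ D / x := fun p => (le_div_iff₀ hx).2 (h p)
  have hone : 1 ≤ D / x := by simpa [hM0] using hle 0
  have hM : assocM Mp ρ ≤ Real.log (D / x) := ciSup_le fun p =>
    max_le (Real.log_le_log (div_pos (pow_pos hρ p) (hMpos p)) (hle p)) (Real.log_nonneg hone)
  have hexp : Real.exp (assocM Mp ρ) ≤ D / x :=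
    (Real.le_log_iff_exp_le (zero_lt_one.trans_le hone)).1 hM
  rw [Real.exp_neg, ← div_eq_mul_inv, le_div_iff₀ (Real.exp_pos _), mul_comm]
  exact (le_div_iff₀ hx).1 hexp

theorem stmt8 (Mp : ℕ → ℝ) (hMpos : ∀ p, 0 < Mp p) (hM0 : Mp 0 = 1)
    (φ : ℝ → ℂ) (hφ : ContDiff ℝ (⊤ : ℕ∞) φ) (hφc : HasCompactSupport φ)
    (hφM : ∀ h : ℝ, 0 < h → ∃ B : ℝ,
      ∀ (t : ℝ) (p : ℕ), ‖iteratedDeriv p φ t‖ ≤ B * h ^ p * Mp p) :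
    ∀ k : ℝ, 0 < k → ∃ C : ℝ, 0 < C ∧ ∀ ε ∈ Set.Ioo (0 : ℝ) 1,
      ‖∫ t : ℝ, Complex.exp (Complex.I * (t : ℂ) / (ε : ℂ)) * φ t‖ ≤
        C * Real.exp (-assocM Mp (k / ε)) := by
  intro k hk
  obtain ⟨B, hB⟩ := hφM k⁻¹ (inv_pos.2 hk)
  have hB0 : 0 ≤ B := by simpa [hM0] using (norm_nonneg _).trans (hB 0 0)
  refine ⟨B * volume.real (tsupport φ) + 1, by positivity, fun ε hε => ?_⟩
  refine le_mul_exp_neg_assocM hMpos hM0 (div_pos hk hε.1) (norm_nonneg _) (by positivity)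
    fun p => ?_
  have hp := inv_pow_mul_norm_integral_exp_mul_le hφ hφc (fun t => hB t p) hε.1
  have hMp := hMpos p
  calc (k / ε) ^ p / Mp p * ‖∫ t : ℝ, Complex.exp (Complex.I * (t : ℂ) / (ε : ℂ)) * φ t‖
      = k ^ p / Mp p *
          (ε⁻¹ ^ p * ‖∫ t : ℝ, Complex.exp (Complex.I * (t : ℂ) / (ε : ℂ)) * φ t‖) := by
        rw [div_eq_mul_inv k, mul_pow]; ring
    _ ≤ k ^ p / Mp p * (B * k⁻¹ ^ p * Mp p * volume.real (tsupport φ)) := by gcongr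
    _ = B * volume.real (tsupport φ) := by
        rw [inv_pow]
        field_simp
    _ ≤ B * volume.real (tsupport φ) + 1 := by linarith
end

section
/- Let X be a complex Banach space, (u_ε)_{ε∈(0,1)} a family of continuous linear functionals on X, and w : (0,1) → (0,∞) an arbitrary function. Assume that for every φ ∈ X there exist C > 0 and ε_0 ∈ (0,1) such that w(ε)·|u_ε(φ)| ≤ C for all ε < ε_0. Then there exist C > 0 and ε_0 ∈ (0,1) such that w(ε)·|u_ε(φ)| ≤ C·‖φ‖ for all φ ∈ X and all ε < ε_0. -/
open scoped BigOperators

theorem stmt10 {X : Type*} [NormedAddCommGroup X] [NormedSpace ℂ X] [CompleteSpace X]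
    (u : ℝ → (X →L[ℂ] ℂ)) (w : ℝ → ℝ) (hw : ∀ ε ∈ Set.Ioo (0 : ℝ) 1, 0 < w ε)
    (hyp : ∀ φ : X, ∃ C : ℝ, 0 < C ∧ ∃ ε₀ ∈ Set.Ioo (0 : ℝ) 1,
      ∀ ε : ℝ, 0 < ε → ε < ε₀ → w ε * ‖u ε φ‖ ≤ C) :
    ∃ C : ℝ, 0 < C ∧ ∃ ε₀ ∈ Set.Ioo (0 : ℝ) 1,
      ∀ φ : X, ∀ ε : ℝ, 0 < ε → ε < ε₀ → w ε * ‖u ε φ‖ ≤ C * ‖φ‖ := by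
  let F : ℕ → Set X := fun n =>
    {φ | ∀ ε : ℝ, 0 < ε → ε < 1 / ((n : ℝ) + 2) → w ε * ‖u ε φ‖ ≤ n}
  have hF_closed : ∀ n, IsClosed (F n) := by
    intro n
    simp only [F, Set.ofPred_forall]
    refine isClosed_iInter fun ε => isClosed_iInter fun _ => isClosed_iInter fun _ => ?_
    exact isClosed_le (by fun_prop) continuous_const
  have hF_cover : ⋃ n, F n = Set.univ := by
    refine Set.eq_univ_of_forall fun φ => Set.mem_iUnion.2 ?_
    obtain ⟨C, -, ε₀, hε₀, h⟩ := hyp φ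
    obtain ⟨n, hn⟩ := exists_nat_ge (max C (1 / ε₀))
    refine ⟨n, fun ε hpos hlt => (h ε hpos (hlt.trans_le ?_)).trans ((le_max_left _ _).trans hn)⟩
    have hle : 1 / ε₀ ≤ (n : ℝ) + 2 := by linarith [(le_max_right C (1 / ε₀)).trans hn]
    exact (one_div_le hε₀.1 (by positivity)).1 hle
  obtain ⟨n, x, hx⟩ := nonempty_interior_of_iUnion_of_closed hF_closed hF_cover
  obtain ⟨r, hr, hball⟩ := Metric.isOpen_iff.1 isOpen_interior x hx
  have hxF : x ∈ F n := interior_subset hx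
  have hinv : 1 / ((n : ℝ) + 2) < 1 := by
    rw [div_lt_one (by positivity)]
    linarith [n.cast_nonneg (α := ℝ)]
  refine ⟨4 * (n + 1) / r, by positivity, 1 / ((n : ℝ) + 2), ⟨by positivity, hinv⟩,
    fun φ ε hpos hlt => ?_⟩
  rcases eq_or_ne φ 0 with rfl | hφ
  · simp
  have hnorm : 0 < ‖φ‖ := norm_pos_iff.2 hφ
  have hwε : 0 < w ε := hw ε ⟨hpos, hlt.trans hinv⟩
  set t : ℝ := r / (2 * ‖φ‖) with ht
  have htpos : 0 < t := by positivity
  have hmem : x + (t : ℂ) • φ ∈ F n := by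
    refine interior_subset (hball ?_)
    rw [Metric.mem_ball, dist_eq_norm, add_sub_cancel_left, norm_smul, Complex.norm_real,
      Real.norm_of_nonneg htpos.le, ht]
    have : r / (2 * ‖φ‖) * ‖φ‖ = r / 2 := by field_simp
    linarith
  have hscaled : t * ‖u ε φ‖ ≤ ‖u ε (x + (t : ℂ) • φ)‖ + ‖u ε x‖ := by
    have := norm_sub_le (u ε (x + (t : ℂ) • φ)) (u ε x)
    rwa [← map_sub, add_sub_cancel_left, map_smul, norm_smul, Complex.norm_real,
      Real.norm_of_nonneg htpos.le] at this
  have hbound : t * (w ε * ‖u ε φ‖) ≤ 2 * (n + 1) := by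
    have := mul_le_mul_of_nonneg_left hscaled hwε.le
    linarith [hmem ε hpos hlt, hxF ε hpos hlt]
  have hC : 4 * ((n : ℝ) + 1) / r * ‖φ‖ = 2 * (n + 1) / t := by
    rw [ht]
    field_simp
    ring
  rw [hC, le_div_iff₀' htpos]
  exact hbound
end

section
/- Let K ⊂ ℝ^d be compact and let (f_ε)_{ε∈(0,1)} be a net of smooth functions on ℝ^d with supp f_ε ⊆ K for all ε, which is (M_p)-moderate. Assume there exist r̃ > 0 and a compact set K_1 ⊂ ℝ^d with K contained in the interior of K_1 such that for every smooth function φ : ℝ^d → ℂ with supp φ ⊆ K_1 and sup_{x∈ℝ^d, α∈ℕ^d} |∂^α φ(x)|/(r̃^{|α|} M_{|α|}) < ∞, the net of complex numbers (∫_{ℝ^d} f_ε(x) φ(x) dx)_{ε∈(0,1)} satisfies: for every k > 0 there are C > 0 and ε_0 ∈ (0,1) with |∫ f_ε φ dx| ≤ C·e^{−M(k/ε)} for all ε < ε_0. Then (f_ε) is (M_p)-negligible. -/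
open scoped BigOperators

/-- The partial derivative `∂_j` of a function on `ℝ^d`. -/
noncomputable def pderiv1 {d : ℕ} (j : Fin d) (f : EuclideanSpace ℝ (Fin d) → ℂ) :
    EuclideanSpace ℝ (Fin d) → ℂ :=
  fun x => fderiv ℝ f x (EuclideanSpace.single j 1)

/-- The multi-index partial derivative `∂^α = ∂_1^{α_1} ⋯ ∂_d^{α_d}`. -/
noncomputable def mderiv {d : ℕ} (α : Fin d → ℕ) (f : EuclideanSpace ℝ (Fin d) → ℂ) :
    EuclideanSpace ℝ (Fin d) → ℂ :=
  (List.finRange d).foldr (fun j g => (pderiv1 j)^[α j] g) f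

/-- An `(M_p)`-moderate net of smooth functions on `ℝ^d`. -/
def ModerateB {d : ℕ} (Mp : ℕ → ℝ) (f : ℝ → EuclideanSpace ℝ (Fin d) → ℂ) : Prop :=
  ∀ K' : Set (EuclideanSpace ℝ (Fin d)), IsCompact K' → ∀ h : ℝ, 0 < h →
    ∃ k : ℝ, 0 < k ∧ ∃ C : ℝ, 0 < C ∧ ∃ ε₀ ∈ Set.Ioo (0 : ℝ) 1,
      ∀ ε : ℝ, 0 < ε → ε < ε₀ → ∀ x ∈ K', ∀ α : Fin d → ℕ,
        ‖mderiv α (f ε) x‖ / (h ^ (∑ j, α j) * Mp (∑ j, α j)) ≤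
          C * Real.exp (assocM Mp (k / ε))

/-- An `(M_p)`-negligible net of smooth functions on `ℝ^d`. -/
def NegligibleB {d : ℕ} (Mp : ℕ → ℝ) (f : ℝ → EuclideanSpace ℝ (Fin d) → ℂ) : Prop :=
  ∀ K' : Set (EuclideanSpace ℝ (Fin d)), IsCompact K' → ∀ h : ℝ, 0 < h → ∀ k : ℝ, 0 < k →
    ∃ C : ℝ, 0 < C ∧ ∃ ε₀ ∈ Set.Ioo (0 : ℝ) 1,
      ∀ ε : ℝ, 0 < ε → ε < ε₀ → ∀ x ∈ K', ∀ α : Fin d → ℕ,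
        ‖mderiv α (f ε) x‖ / (h ^ (∑ j, α j) * Mp (∑ j, α j)) ≤
          C * Real.exp (-assocM Mp (k / ε))

/-- The iterated partial derivative `∂^α` restricted to the directions occurring in a list. -/
noncomputable def listDeriv {d : ℕ} (L : List (Fin d)) (α : Fin d → ℕ)
    (f : EuclideanSpace ℝ (Fin d) → ℂ) : EuclideanSpace ℝ (Fin d) → ℂ :=
  L.foldr (fun j g => (pderiv1 j)^[α j] g) f

lemma mderiv_eq_listDeriv {d : ℕ} (α : Fin d → ℕ) (f : EuclideanSpace ℝ (Fin d) → ℂ) :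
    mderiv α f = listDeriv (List.finRange d) α f := rfl

lemma listDeriv_cons {d : ℕ} (j : Fin d) (L : List (Fin d)) (α : Fin d → ℕ)
    (f : EuclideanSpace ℝ (Fin d) → ℂ) :
    listDeriv (j :: L) α f = (pderiv1 j)^[α j] (listDeriv L α f) := rfl

/-- A property of functions that is stable under partial derivatives is stable under `listDeriv`. -/
lemma listDeriv_induction {d : ℕ} {P : (EuclideanSpace ℝ (Fin d) → ℂ) → Prop}
    (hP : ∀ j f, P f → P (pderiv1 j f)) (L : List (Fin d)) (α : Fin d → ℕ)
    {f : EuclideanSpace ℝ (Fin d) → ℂ} (hf : P f) : P (listDeriv L α f) := by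
  induction L with
  | nil => exact hf
  | cons j L ih => exact Function.Iterate.rec P ih (fun g hg => hP j g hg) (α j)

lemma ContDiff.pderiv1 {d : ℕ} (j : Fin d) {f : EuclideanSpace ℝ (Fin d) → ℂ}
    (hf : ContDiff ℝ (⊤ : ℕ∞) f) : ContDiff ℝ (⊤ : ℕ∞) (pderiv1 j f) :=
  (contDiff_infty_iff_fderiv.1 hf).2.clm_apply contDiff_const

lemma ContDiff.mderiv {d : ℕ} (α : Fin d → ℕ) {f : EuclideanSpace ℝ (Fin d) → ℂ}
    (hf : ContDiff ℝ (⊤ : ℕ∞) f) : ContDiff ℝ (⊤ : ℕ∞) (mderiv α f) :=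
  listDeriv_induction (fun j _ h => h.pderiv1 j) _ α hf

lemma tsupport_pderiv1_subset {d : ℕ} (j : Fin d) (f : EuclideanSpace ℝ (Fin d) → ℂ) :
    tsupport (pderiv1 j f) ⊆ tsupport f := by
  refine (closure_mono fun x hx => ?_).trans (tsupport_fderiv_subset ℝ (f := f))
  rw [Function.mem_support] at hx ⊢
  intro h0
  exact hx (by simp [pderiv1, h0])

lemma HasCompactSupport.pderiv1 {d : ℕ} (j : Fin d) {f : EuclideanSpace ℝ (Fin d) → ℂ}
    (hf : HasCompactSupport f) : HasCompactSupport (pderiv1 j f) :=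
  hf.mono' (subset_closure.trans (tsupport_pderiv1_subset j f))

lemma pderiv1_iterate_induction {d : ℕ} {P : (EuclideanSpace ℝ (Fin d) → ℂ) → Prop} (j : Fin d)
    (hP : ∀ f, P f → P (pderiv1 j f)) (n : ℕ) {f : EuclideanSpace ℝ (Fin d) → ℂ} (hf : P f) :
    P ((pderiv1 j)^[n] f) := by
  induction n with
  | zero => exact hf
  | succ n ih => rw [Function.iterate_succ_apply']; exact hP _ ih

lemma tsupport_mderiv_subset {d : ℕ} (α : Fin d → ℕ) (f : EuclideanSpace ℝ (Fin d) → ℂ) :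
    tsupport (mderiv α f) ⊆ tsupport f :=
  listDeriv_induction (P := fun g => tsupport g ⊆ tsupport f)
    (fun j g h => (tsupport_pderiv1_subset j g).trans h) _ α subset_rfl

lemma pderiv1_comm {d : ℕ} (i j : Fin d) {f : EuclideanSpace ℝ (Fin d) → ℂ}
    (hf : ContDiff ℝ (⊤ : ℕ∞) f) : pderiv1 i (pderiv1 j f) = pderiv1 j (pderiv1 i f) := by
  have hd : Differentiable ℝ f := (contDiff_infty_iff_fderiv.1 hf).1
  have hd' : Differentiable ℝ (fderiv ℝ f) :=
    (contDiff_infty_iff_fderiv.1 (contDiff_infty_iff_fderiv.1 hf).2).1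
  have key : ∀ (a b : Fin d) (x), pderiv1 a (pderiv1 b f) x =
      fderiv ℝ (fderiv ℝ f) x (EuclideanSpace.single a 1) (EuclideanSpace.single b 1) := by
    intro a b x
    have := ((hd' x).hasFDerivAt.clm_apply
      (hasFDerivAt_const (EuclideanSpace.single b (1 : ℝ)) x)).fderiv
    unfold pderiv1
    rw [this]
    simp
  ext x
  rw [key, key]
  exact second_derivative_symmetric (fun y => (hd y).hasFDerivAt) (hd' x).hasFDerivAt _ _

lemma pderiv1_iterate_comm {d : ℕ} (i j : Fin d) (n : ℕ) {f : EuclideanSpace ℝ (Fin d) → ℂ}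
    (hf : ContDiff ℝ (⊤ : ℕ∞) f) :
    pderiv1 i ((pderiv1 j)^[n] f) = (pderiv1 j)^[n] (pderiv1 i f) := by
  induction n generalizing f with
  | zero => rfl
  | succ n ih =>
    rw [Function.iterate_succ_apply, Function.iterate_succ_apply, ih (hf.pderiv1 j),
      pderiv1_comm i j hf]

lemma pderiv1_listDeriv_comm {d : ℕ} (i : Fin d) (L : List (Fin d)) (α : Fin d → ℕ)
    {f : EuclideanSpace ℝ (Fin d) → ℂ} (hf : ContDiff ℝ (⊤ : ℕ∞) f) :
    pderiv1 i (listDeriv L α f) = listDeriv L α (pderiv1 i f) := by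
  induction L with
  | nil => rfl
  | cons j L ih =>
    rw [listDeriv_cons, listDeriv_cons, pderiv1_iterate_comm, ih]
    exact listDeriv_induction (fun j _ h => h.pderiv1 j) _ α hf

lemma pderiv1_iterate_listDeriv_comm {d : ℕ} (i : Fin d) (n : ℕ) (L : List (Fin d))
    (α : Fin d → ℕ) {f : EuclideanSpace ℝ (Fin d) → ℂ} (hf : ContDiff ℝ (⊤ : ℕ∞) f) :
    (pderiv1 i)^[n] (listDeriv L α f) = listDeriv L α ((pderiv1 i)^[n] f) := by
  induction n generalizing f with
  | zero => rfl
  | succ n ih =>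
    rw [Function.iterate_succ_apply, Function.iterate_succ_apply, pderiv1_listDeriv_comm i L α hf,
      ih (hf.pderiv1 i)]

lemma listDeriv_listDeriv {d : ℕ} (L : List (Fin d)) (α β : Fin d → ℕ)
    {f : EuclideanSpace ℝ (Fin d) → ℂ} (hf : ContDiff ℝ (⊤ : ℕ∞) f) :
    listDeriv L α (listDeriv L β f) = listDeriv L (α + β) f := by
  induction L with
  | nil => rfl
  | cons j L ih =>
    rw [listDeriv_cons, listDeriv_cons, listDeriv_cons, ← pderiv1_iterate_listDeriv_comm, ih,
      ← Function.iterate_add_apply, Pi.add_apply]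
    exact listDeriv_induction (fun j _ h => h.pderiv1 j) _ β hf

lemma mderiv_mderiv {d : ℕ} (α β : Fin d → ℕ)
    {f : EuclideanSpace ℝ (Fin d) → ℂ} (hf : ContDiff ℝ (⊤ : ℕ∞) f) :
    mderiv α (mderiv β f) = mderiv (α + β) f :=
  listDeriv_listDeriv _ α β hf

lemma listDeriv_eq_self {d : ℕ} (L : List (Fin d)) (α : Fin d → ℕ) (hα : ∀ j ∈ L, α j = 0)
    (f : EuclideanSpace ℝ (Fin d) → ℂ) : listDeriv L α f = f := by
  induction L with
  | nil => rfl
  | cons j L ih =>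
    rw [listDeriv_cons, hα j (by simp), ih fun i hi => hα i (by simp [hi])]
    rfl

lemma mderiv_zero {d : ℕ} (f : EuclideanSpace ℝ (Fin d) → ℂ) : mderiv 0 f = f :=
  listDeriv_eq_self _ 0 (fun _ _ => rfl) f

lemma mderiv_single {d : ℕ} (i : Fin d) (f : EuclideanSpace ℝ (Fin d) → ℂ) :
    mderiv (Pi.single i 1) f = pderiv1 i f := by
  have key : ∀ L : List (Fin d), L.Nodup → i ∈ L →
      listDeriv L (Pi.single i 1) f = pderiv1 i f := by
    intro L hL hi
    induction L with
    | nil => simp at hi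
    | cons j L ih =>
      rw [List.nodup_cons] at hL
      rw [listDeriv_cons]
      by_cases hij : i = j
      · subst hij
        rw [listDeriv_eq_self, Pi.single_eq_same]
        · rfl
        · intro k hk
          exact Pi.single_eq_of_ne (by rintro rfl; exact hL.1 hk) _
      · rw [Pi.single_eq_of_ne (Ne.symm hij), ih hL.2 ((List.mem_cons.1 hi).resolve_left hij)]
        rfl
  exact key _ (List.nodup_finRange d) (List.mem_finRange i)

lemma mderiv_pderiv1 {d : ℕ} (α : Fin d → ℕ) (i : Fin d)
    {f : EuclideanSpace ℝ (Fin d) → ℂ} (hf : ContDiff ℝ (⊤ : ℕ∞) f) :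
    mderiv α (pderiv1 i f) = mderiv (α + Pi.single i 1) f := by
  rw [← mderiv_single, mderiv_mderiv _ _ hf]

lemma pderiv1_mderiv {d : ℕ} (α : Fin d → ℕ) (i : Fin d)
    {f : EuclideanSpace ℝ (Fin d) → ℂ} (hf : ContDiff ℝ (⊤ : ℕ∞) f) :
    pderiv1 i (mderiv α f) = mderiv (α + Pi.single i 1) f := by
  rw [← mderiv_pderiv1 α i hf]
  exact pderiv1_listDeriv_comm i _ α hf

/-- Partial derivatives commute with continuous real-linear maps of the target. -/
lemma mderiv_clm_comp {d : ℕ} (T : ℂ →L[ℝ] ℂ) (α : Fin d → ℕ)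
    {f : EuclideanSpace ℝ (Fin d) → ℂ} (hf : ContDiff ℝ (⊤ : ℕ∞) f) :
    mderiv α (fun x => T (f x)) = fun x => T (mderiv α f x) := by
  have hstep : ∀ (j : Fin d) (g : EuclideanSpace ℝ (Fin d) → ℂ), ContDiff ℝ (⊤ : ℕ∞) g →
      pderiv1 j (fun x => T (g x)) = fun x => T (pderiv1 j g x) := by
    intro j g hg
    ext x
    have := (T.hasFDerivAt.comp x ((contDiff_infty_iff_fderiv.1 hg).1 x).hasFDerivAt).fderiv
    simp only [pderiv1]
    erw [this]
    rfl
  have hiter : ∀ (j : Fin d) (n : ℕ) (g : EuclideanSpace ℝ (Fin d) → ℂ),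
      ContDiff ℝ (⊤ : ℕ∞) g →
      (pderiv1 j)^[n] (fun x => T (g x)) = fun x => T ((pderiv1 j)^[n] g x) := by
    intro j n
    induction n with
    | zero => intro g _; rfl
    | succ n ih =>
      intro g hg
      simp only [Function.iterate_succ_apply]
      rw [hstep j g hg, ih _ (hg.pderiv1 j)]
  simp only [mderiv_eq_listDeriv]
  induction List.finRange d with
  | nil => rfl
  | cons j L ih =>
    rw [listDeriv_cons, listDeriv_cons, ih, hiter]
    exact listDeriv_induction (fun j _ h => h.pderiv1 j) _ α hf

lemma norm_fderiv_le_sum_pderiv1 {d : ℕ} (f : EuclideanSpace ℝ (Fin d) → ℂ)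
    (x : EuclideanSpace ℝ (Fin d)) : ‖fderiv ℝ f x‖ ≤ ∑ i, ‖pderiv1 i f x‖ := by
  refine ContinuousLinearMap.opNorm_le_bound _ (by positivity) fun v => ?_
  have hv : v = ∑ i, v i • EuclideanSpace.single i (1 : ℝ) := by
    simpa using ((EuclideanSpace.basisFun (Fin d) ℝ).sum_repr v).symm
  calc ‖fderiv ℝ f x v‖ = ‖∑ i, v i • pderiv1 i f x‖ := by
        conv_lhs => rw [hv]
        simp [map_sum, pderiv1]
    _ ≤ ∑ i, ‖v i • pderiv1 i f x‖ := norm_sum_le _ _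
    _ ≤ ∑ i, ‖pderiv1 i f x‖ * ‖v‖ := by
        refine Finset.sum_le_sum fun i _ => ?_
        rw [norm_smul, mul_comm]
        gcongr
        exact PiLp.norm_apply_le v i
    _ = (∑ i, ‖pderiv1 i f x‖) * ‖v‖ := by rw [Finset.sum_mul]

lemma contDiff_succ_of_pderiv1 {d : ℕ} {f : EuclideanSpace ℝ (Fin d) → ℂ} {n : ℕ}
    (hf : Differentiable ℝ f) (h : ∀ i, ContDiff ℝ n (pderiv1 i f)) :
    ContDiff ℝ (n + 1 : ℕ) f := by
  have : ((n + 1 : ℕ) : WithTop ℕ∞) = n + 1 := by push_cast; rfl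
  rw [this, contDiff_succ_iff_fderiv_apply]
  refine ⟨hf, by simp, fun v => ?_⟩
  have hv : v = ∑ i, v i • EuclideanSpace.single i (1 : ℝ) := by
    simpa using ((EuclideanSpace.basisFun (Fin d) ℝ).sum_repr v).symm
  have : (fun x => fderiv ℝ f x v) = fun x => ∑ i, v i • pderiv1 i f x := by
    ext x
    conv_lhs => rw [hv]
    simp [map_sum, pderiv1]
  rw [this]
  exact ContDiff.sum fun i _ => (h i).const_smul (v i)

lemma integral_mul_pderiv1 {d : ℕ} (j : Fin d) {u v : EuclideanSpace ℝ (Fin d) → ℂ}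
    (hu : ContDiff ℝ (⊤ : ℕ∞) u) (hv : ContDiff ℝ (⊤ : ℕ∞) v) (hc : HasCompactSupport u) :
    ∫ x, u x * pderiv1 j v x = -∫ x, pderiv1 j u x * v x := by
  refine integral_mul_fderiv_eq_neg_fderiv_mul_of_integrable ?_ ?_ ?_ ?_ ?_
  · exact ((hu.pderiv1 j).continuous.mul hv.continuous).integrable_of_hasCompactSupport
      (hc.pderiv1 j).mul_right
  · exact (hu.continuous.mul (hv.pderiv1 j).continuous).integrable_of_hasCompactSupport
      hc.mul_right
  · exact (hu.continuous.mul hv.continuous).integrable_of_hasCompactSupport hc.mul_right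
  · exact fun x _ => hu.differentiable (by simp) x
  · exact fun x _ => hv.differentiable (by simp) x

lemma norm_integral_mul_iterate_pderiv1 {d : ℕ} (j : Fin d) (n : ℕ)
    {u v : EuclideanSpace ℝ (Fin d) → ℂ}
    (hu : ContDiff ℝ (⊤ : ℕ∞) u) (hv : ContDiff ℝ (⊤ : ℕ∞) v) (hc : HasCompactSupport u) :
    ‖∫ x, u x * (pderiv1 j)^[n] v x‖ = ‖∫ x, (pderiv1 j)^[n] u x * v x‖ := by
  induction n generalizing u v with
  | zero => rfl
  | succ n ih =>
    have hu' := pderiv1_iterate_induction (P := fun g => ContDiff ℝ (⊤ : ℕ∞) g) j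
      (fun g hg => hg.pderiv1 j) n hu
    have hc' := pderiv1_iterate_induction (P := fun g => HasCompactSupport g) j
      (fun g hg => hg.pderiv1 j) n hc
    rw [Function.iterate_succ_apply, ih hu (hv.pderiv1 j) hc, integral_mul_pderiv1 j hu' hv hc',
      norm_neg, Function.iterate_succ_apply']

lemma norm_integral_mul_mderiv {d : ℕ} (α : Fin d → ℕ) {u v : EuclideanSpace ℝ (Fin d) → ℂ}
    (hu : ContDiff ℝ (⊤ : ℕ∞) u) (hv : ContDiff ℝ (⊤ : ℕ∞) v) (hc : HasCompactSupport u) :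
    ‖∫ x, u x * mderiv α v x‖ = ‖∫ x, mderiv α u x * v x‖ := by
  simp only [mderiv_eq_listDeriv]
  induction List.finRange d generalizing u v with
  | nil => rfl
  | cons j L ih =>
    have hu' := pderiv1_iterate_induction (P := fun g => ContDiff ℝ (⊤ : ℕ∞) g) j
      (fun g hg => hg.pderiv1 j) (α j) hu
    have hc' := pderiv1_iterate_induction (P := fun g => HasCompactSupport g) j
      (fun g hg => hg.pderiv1 j) (α j) hc
    have hv' := listDeriv_induction (P := fun g => ContDiff ℝ (⊤ : ℕ∞) g)
      (fun j g hg => hg.pderiv1 j) L α hv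
    rw [listDeriv_cons, listDeriv_cons, norm_integral_mul_iterate_pderiv1 j (α j) hu hv' hc,
      ih hu' hv hc', pderiv1_iterate_listDeriv_comm j _ L α hu]

/-- A Lipschitz function is controlled in the supremum norm by its `L²` norm. -/
lemma norm_pow_le_of_norm_fderiv_le {d : ℕ} {g : EuclideanSpace ℝ (Fin d) → ℂ}
    (hg : Differentiable ℝ g) (hc : HasCompactSupport g) {L : ℝ} (hL : 0 < L)
    (hgL : ∀ x, ‖fderiv ℝ g x‖ ≤ L) (x : EuclideanSpace ℝ (Fin d)) :
    ‖g x‖ ^ (d + 2) * MeasureTheory.volume.real (Metric.ball (0 : EuclideanSpace ℝ (Fin d)) 1) ≤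
      2 ^ (d + 2) * L ^ d * ∫ y, ‖g y‖ ^ 2 := by
  have hI : 0 ≤ ∫ y, ‖g y‖ ^ 2 := MeasureTheory.integral_nonneg fun y => by positivity
  rcases (norm_nonneg (g x)).eq_or_lt with h0 | h0
  · rw [← h0, zero_pow (by omega), zero_mul]; positivity
  set m := ‖g x‖
  set r := m / (2 * L) with hr
  have hr0 : 0 < r := by positivity
  set v := MeasureTheory.volume.real (Metric.ball (0 : EuclideanSpace ℝ (Fin d)) 1)
  have hint : MeasureTheory.Integrable (fun y => ‖g y‖ ^ 2) := by
    refine (hg.continuous.norm.pow 2).integrable_of_hasCompactSupport ?_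
    refine hc.mono fun y hy hy0 => hy ?_
    simp [hy0]
  have hvol : MeasureTheory.volume.real (Metric.ball x r) = r ^ d * v := by
    rw [MeasureTheory.measureReal_def, MeasureTheory.Measure.addHaar_ball_of_pos _ x hr0,
      ENNReal.toReal_mul, ENNReal.toReal_ofReal (by positivity), finrank_euclideanSpace_fin,
      ← MeasureTheory.measureReal_def]
  have hlow : ∀ y ∈ Metric.ball x r, (m / 2) ^ 2 ≤ ‖g y‖ ^ 2 := by
    intro y hy
    have h1 := Convex.norm_image_sub_le_of_norm_fderiv_le (𝕜 := ℝ) (f := g) (C := L)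
      (fun z _ => hg z) (fun z _ => hgL z) convex_univ (Set.mem_univ x) (Set.mem_univ y)
    have h2 : ‖y - x‖ < r := by simpa [dist_eq_norm] using hy
    have h3 : L * ‖y - x‖ ≤ m / 2 := by
      calc L * ‖y - x‖ ≤ L * r := by gcongr
        _ = m / 2 := by rw [hr]; field_simp
    have h4 : m - ‖g y‖ ≤ ‖g y - g x‖ := by
      rw [norm_sub_rev]; exact norm_sub_norm_le _ _
    gcongr
    linarith
  have h5 : (m / 2) ^ 2 * (r ^ d * v) ≤ ∫ y, ‖g y‖ ^ 2 := by
    calc (m / 2) ^ 2 * (r ^ d * v) = ∫ _ in Metric.ball x r, (m / 2) ^ 2 := by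
          rw [MeasureTheory.setIntegral_const, hvol, smul_eq_mul, mul_comm]
      _ ≤ ∫ y in Metric.ball x r, ‖g y‖ ^ 2 := by
          refine MeasureTheory.setIntegral_mono_on ?_ hint.integrableOn measurableSet_ball hlow
          exact MeasureTheory.integrableOn_const (by finiteness)
      _ ≤ ∫ y, ‖g y‖ ^ 2 :=
          MeasureTheory.setIntegral_le_integral hint
            (Filter.Eventually.of_forall fun y => by positivity)
  calc m ^ (d + 2) * v = 2 ^ (d + 2) * L ^ d * ((m / 2) ^ 2 * (r ^ d * v)) := by
        rw [hr, div_pow, div_pow, mul_pow]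
        field_simp
        ring
    _ ≤ _ := by gcongr

lemma assocM_le {Mp : ℕ → ℝ} (hM0 : Mp 0 = 1) {ρ c : ℝ}
    (h : ∀ p, Real.log (ρ ^ p / Mp p) ≤ c) : assocM Mp ρ ≤ c :=
  ciSup_le fun p => max_le (h p) (by simpa [hM0] using h 0)

lemma log_le_assocM {Mp : ℕ → ℝ} {ρ : ℝ}
    (hb : BddAbove (Set.range fun p : ℕ => logPlus (ρ ^ p / Mp p))) (p : ℕ) :
    Real.log (ρ ^ p / Mp p) ≤ assocM Mp ρ :=
  (le_max_left _ _).trans (le_ciSup hb p)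

lemma assocM_mono {Mp : ℕ → ℝ} (hMpos : ∀ p, 0 < Mp p) (hM0 : Mp 0 = 1) {ρ σ : ℝ}
    (hρ : 0 < ρ) (h : ρ ≤ σ) (hb : BddAbove (Set.range fun p : ℕ => logPlus (σ ^ p / Mp p))) :
    assocM Mp ρ ≤ assocM Mp σ := by
  refine assocM_le hM0 fun p => (Real.log_le_log ?_ ?_).trans (log_le_assocM hb p)
  · have := hMpos p; positivity
  · have := hMpos p; gcongr

/-- Condition (M.2) in terms of the associated function. -/
lemma two_mul_assocM_le {Mp : ℕ → ℝ} (hMpos : ∀ p, 0 < Mp p) (hM0 : Mp 0 = 1) {c0 H : ℝ}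
    (hc0 : 1 ≤ c0) (hH : 1 ≤ H) (hM2 : CondM2 Mp c0 H) {ρ : ℝ} (hρ : 0 < ρ)
    (hb : BddAbove (Set.range fun p : ℕ => logPlus ((H * ρ) ^ p / Mp p))) :
    assocM Mp ρ + assocM Mp ρ ≤ Real.log c0 + assocM Mp (H * ρ) := by
  have key : ∀ p q, Real.log (ρ ^ p / Mp p) + Real.log (ρ ^ q / Mp q) ≤
      Real.log c0 + assocM Mp (H * ρ) := by
    intro p q
    have hp := hMpos p
    have hq := hMpos q
    have hpq := hMpos (p + q)
    refine le_trans ?_ (add_le_add_right (log_le_assocM hb (p + q)) _)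
    rw [← Real.log_mul (by positivity) (by positivity),
      ← Real.log_mul (by positivity) (by positivity)]
    refine Real.log_le_log (by positivity) ?_
    rw [div_mul_div_comm, mul_div_assoc', div_le_div_iff₀ (by positivity) (by positivity)]
    calc ρ ^ p * ρ ^ q * Mp (p + q) ≤ ρ ^ p * ρ ^ q * (c0 * H ^ (p + q) * Mp p * Mp q) := by
          gcongr; exact hM2 p q
      _ = _ := by rw [mul_pow, pow_add ρ]; ring
  have h1 : ∀ q, Real.log (ρ ^ q / Mp q) ≤ Real.log c0 + assocM Mp (H * ρ) - assocM Mp ρ := by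
    intro q
    have : assocM Mp ρ ≤ Real.log c0 + assocM Mp (H * ρ) - Real.log (ρ ^ q / Mp q) :=
      assocM_le hM0 fun p => by linarith [key p q]
    linarith
  linarith [assocM_le hM0 h1]

lemma exists_nat_mul_assocM_le {Mp : ℕ → ℝ} (hMpos : ∀ p, 0 < Mp p) (hM0 : Mp 0 = 1) {c0 H : ℝ}
    (hc0 : 1 ≤ c0) (hH : 1 ≤ H) (hM2 : CondM2 Mp c0 H)
    (hb : ∀ ρ : ℝ, 0 < ρ → BddAbove (Set.range fun p : ℕ => logPlus (ρ ^ p / Mp p))) (n : ℕ) :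
    ∃ C s : ℝ, 1 ≤ s ∧ ∀ ρ, 0 < ρ → n * assocM Mp ρ ≤ C + assocM Mp (s * ρ) := by
  induction n with
  | zero =>
    refine ⟨0, 1, le_rfl, fun ρ _ => ?_⟩
    have : 0 ≤ assocM Mp (1 * ρ) := Real.iSup_nonneg fun p => le_max_right _ _
    simpa using this
  | succ n ih =>
    obtain ⟨C, s, hs, h⟩ := ih
    refine ⟨C + Real.log c0, H * s, by nlinarith, fun ρ hρ => ?_⟩
    have hsρ : 0 < s * ρ := by positivity
    have h1 := h ρ hρ
    have h2 := assocM_mono hMpos hM0 hρ (by nlinarith : ρ ≤ s * ρ) (hb _ hsρ)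
    have h3 := two_mul_assocM_le hMpos hM0 hc0 hH hM2 hsρ (hb _ (by positivity))
    rw [mul_assoc]
    push_cast
    linarith

lemma summable_mul_of_norm_le {ι : Type*} {a b : ι → ℂ} (ha : Summable fun j => ‖a j‖) {C : ℝ}
    (hb : ∀ j, ‖b j‖ ≤ C) : Summable fun j => a j * b j :=
  Summable.of_norm_bounded (ha.mul_right C) fun j => by
    rw [norm_mul]
    gcongr
    exact hb j

lemma hasFDerivAt_tsum_mul {d : ℕ} {ι : Type*} {ψ : ι → EuclideanSpace ℝ (Fin d) → ℂ}
    (hψ : ∀ j, ContDiff ℝ (⊤ : ℕ∞) (ψ j))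
    (hb : ∀ α : Fin d → ℕ, ∃ C : ℝ, ∀ j x, ‖mderiv α (ψ j) x‖ ≤ C)
    {a : ι → ℂ} (ha : Summable fun j => ‖a j‖) (x : EuclideanSpace ℝ (Fin d)) :
    HasFDerivAt (fun x => ∑' j, a j * ψ j x) (∑' j, a j • fderiv ℝ (ψ j) x) x ∧
      Summable fun j => a j • fderiv ℝ (ψ j) x := by
  obtain ⟨C0, hC0⟩ := hb 0
  choose C hC using fun i : Fin d => hb (Pi.single i 1)
  have hder : ∀ j x, ‖a j • fderiv ℝ (ψ j) x‖ ≤ ‖a j‖ * ∑ i, C i := by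
    intro j x
    rw [norm_smul]
    gcongr
    refine (norm_fderiv_le_sum_pderiv1 _ x).trans (Finset.sum_le_sum fun i _ => ?_)
    rw [← mderiv_single]
    exact hC i j x
  refine ⟨?_, Summable.of_norm_bounded (ha.mul_right _) fun j => hder j x⟩
  refine hasFDerivAt_tsum (x₀ := x) (ha.mul_right (∑ i, C i)) (fun j x => ?_) hder
    (summable_mul_of_norm_le ha fun j => by simpa only [mderiv_zero] using hC0 j x) x
  exact ((hψ j).differentiable (by simp) x).hasFDerivAt.const_smul (a j)

lemma pderiv1_tsum_mul {d : ℕ} {ι : Type*} {ψ : ι → EuclideanSpace ℝ (Fin d) → ℂ}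
    (hψ : ∀ j, ContDiff ℝ (⊤ : ℕ∞) (ψ j))
    (hb : ∀ α : Fin d → ℕ, ∃ C : ℝ, ∀ j x, ‖mderiv α (ψ j) x‖ ≤ C)
    {a : ι → ℂ} (ha : Summable fun j => ‖a j‖) (i : Fin d) :
    pderiv1 i (fun x => ∑' j, a j * ψ j x) = fun x => ∑' j, a j * pderiv1 i (ψ j) x := by
  ext x
  obtain ⟨h1, h2⟩ := hasFDerivAt_tsum_mul hψ hb ha x
  unfold pderiv1
  rw [h1.fderiv]
  exact ((ContinuousLinearMap.apply ℝ ℂ (EuclideanSpace.single i (1 : ℝ))).map_tsum h2).trans rfl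

lemma exists_bound_mderiv_pderiv1 {d : ℕ} {ι : Type*} {ψ : ι → EuclideanSpace ℝ (Fin d) → ℂ}
    (hψ : ∀ j, ContDiff ℝ (⊤ : ℕ∞) (ψ j))
    (hb : ∀ α : Fin d → ℕ, ∃ C : ℝ, ∀ j x, ‖mderiv α (ψ j) x‖ ≤ C) (i : Fin d)
    (α : Fin d → ℕ) : ∃ C : ℝ, ∀ j x, ‖mderiv α (pderiv1 i (ψ j)) x‖ ≤ C := by
  obtain ⟨C, hC⟩ := hb (α + Pi.single i 1)
  exact ⟨C, fun j x => by rw [mderiv_pderiv1 α i (hψ j)]; exact hC j x⟩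

lemma contDiff_tsum_mul {d : ℕ} {ι : Type*} {ψ : ι → EuclideanSpace ℝ (Fin d) → ℂ}
    (hψ : ∀ j, ContDiff ℝ (⊤ : ℕ∞) (ψ j))
    (hb : ∀ α : Fin d → ℕ, ∃ C : ℝ, ∀ j x, ‖mderiv α (ψ j) x‖ ≤ C)
    {a : ι → ℂ} (ha : Summable fun j => ‖a j‖) :
    ContDiff ℝ (⊤ : ℕ∞) (fun x => ∑' j, a j * ψ j x) := by
  rw [contDiff_infty]
  intro n
  induction n generalizing ψ with
  | zero =>
    exact contDiff_zero.2 (continuous_iff_continuousAt.2 fun x =>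
      (hasFDerivAt_tsum_mul hψ hb ha x).1.continuousAt)
  | succ n ih =>
    refine contDiff_succ_of_pderiv1
      (fun x => (hasFDerivAt_tsum_mul hψ hb ha x).1.differentiableAt) fun i => ?_
    rw [pderiv1_tsum_mul hψ hb ha i]
    exact ih (fun j => (hψ j).pderiv1 i) (exists_bound_mderiv_pderiv1 hψ hb i)

lemma mderiv_tsum_mul {d : ℕ} {ι : Type*} {ψ : ι → EuclideanSpace ℝ (Fin d) → ℂ}
    (hψ : ∀ j, ContDiff ℝ (⊤ : ℕ∞) (ψ j))
    (hb : ∀ α : Fin d → ℕ, ∃ C : ℝ, ∀ j x, ‖mderiv α (ψ j) x‖ ≤ C)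
    {a : ι → ℂ} (ha : Summable fun j => ‖a j‖) (α : Fin d → ℕ) :
    mderiv α (fun x => ∑' j, a j * ψ j x) = fun x => ∑' j, a j * mderiv α (ψ j) x := by
  let P : (EuclideanSpace ℝ (Fin d) → ℂ) → (ι → EuclideanSpace ℝ (Fin d) → ℂ) → Prop :=
    fun F φ => (∀ j, ContDiff ℝ (⊤ : ℕ∞) (φ j)) ∧
      (∀ β : Fin d → ℕ, ∃ C : ℝ, ∀ j x, ‖mderiv β (φ j) x‖ ≤ C) ∧
      F = fun x => ∑' j, a j * φ j x
  have hstep : ∀ i F φ, P F φ → P (pderiv1 i F) (fun j => pderiv1 i (φ j)) := by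
    rintro i F φ ⟨h1, h2, rfl⟩
    exact ⟨fun j => (h1 j).pderiv1 i, exists_bound_mderiv_pderiv1 h1 h2 i,
      pderiv1_tsum_mul h1 h2 ha i⟩
  have hiter : ∀ i n F φ, P F φ → P ((pderiv1 i)^[n] F) (fun j => (pderiv1 i)^[n] (φ j)) := by
    intro i n
    induction n with
    | zero => exact fun F φ h => h
    | succ n ih =>
      intro F φ h
      simp only [Function.iterate_succ_apply]
      exact ih _ _ (hstep i F φ h)
  have hlist : ∀ L : List (Fin d), P (listDeriv L α fun x => ∑' j, a j * ψ j x)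
      (fun j => listDeriv L α (ψ j)) := by
    intro L
    induction L with
    | nil => exact ⟨hψ, hb, rfl⟩
    | cons i L ih => exact hiter i (α i) _ _ ih
  exact (hlist _).2.2

lemma integrable_mul_of_hasCompactSupport {d : ℕ} {u v : EuclideanSpace ℝ (Fin d) → ℂ}
    (hu : Continuous u) (hc : HasCompactSupport u) (hv : Continuous v) :
    MeasureTheory.Integrable fun x => u x * v x :=
  (hu.mul hv).integrable_of_hasCompactSupport hc.mul_right

lemma summable_norm_lp_one {ι : Type*} (a : lp (fun _ : ι => ℂ) 1) : Summable fun j => ‖a j‖ := by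
  simpa using (lp.memℓp a).summable (by simp)

lemma tsum_norm_lp_one {ι : Type*} (a : lp (fun _ : ι => ℂ) 1) : ∑' j, ‖a j‖ = ‖a‖ := by
  simpa using (lp.norm_rpow_eq_tsum (p := 1) (by simp) a).symm

/-- The functional `a ↦ ∫ u · (∑ a_j ψ_j)` on `ℓ¹`. -/
lemma exists_clm_integral_tsum_mul {d : ℕ} {ψ : ℕ → EuclideanSpace ℝ (Fin d) → ℂ}
    (hψ : ∀ j, ContDiff ℝ (⊤ : ℕ∞) (ψ j))
    (hb : ∀ α : Fin d → ℕ, ∃ C : ℝ, ∀ j x, ‖mderiv α (ψ j) x‖ ≤ C)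
    {u : EuclideanSpace ℝ (Fin d) → ℂ} (hu : Continuous u) (hc : HasCompactSupport u) :
    ∃ T : lp (fun _ : ℕ => ℂ) 1 →L[ℂ] ℂ, ∀ a, T a = ∫ x, u x * ∑' j, a j * ψ j x := by
  obtain ⟨C, hC⟩ := hb 0
  simp only [mderiv_zero] at hC
  have hs : ∀ (a : lp (fun _ : ℕ => ℂ) 1) x, Summable fun j => a j * ψ j x := fun a x =>
    summable_mul_of_norm_le (summable_norm_lp_one a) fun j => hC j x
  have hi : ∀ a : lp (fun _ : ℕ => ℂ) 1,
      MeasureTheory.Integrable fun x => u x * ∑' j, a j * ψ j x := fun a =>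
    integrable_mul_of_hasCompactSupport hu hc
      (contDiff_tsum_mul hψ hb (summable_norm_lp_one a)).continuous
  let T₀ : lp (fun _ : ℕ => ℂ) 1 →ₗ[ℂ] ℂ :=
    { toFun := fun a => ∫ x, u x * ∑' j, a j * ψ j x
      map_add' := fun a b => by
        rw [← MeasureTheory.integral_add (hi a) (hi b)]
        refine MeasureTheory.integral_congr_ae (Filter.Eventually.of_forall fun x => ?_)
        simp only [lp.coeFn_add, Pi.add_apply, add_mul]
        rw [(hs a x).tsum_add (hs b x), mul_add]
      map_smul' := fun c a => by
        simp only [RingHom.id_apply, smul_eq_mul]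
        rw [← MeasureTheory.integral_const_mul]
        refine MeasureTheory.integral_congr_ae (Filter.Eventually.of_forall fun x => ?_)
        simp only [lp.coeFn_smul, Pi.smul_apply, smul_eq_mul, mul_assoc]
        rw [tsum_mul_left]
        ring }
  have hui : MeasureTheory.Integrable fun x => ‖u x‖ :=
    (hu.integrable_of_hasCompactSupport hc).norm
  refine ⟨T₀.mkContinuous ((∫ x, ‖u x‖) * C) fun a => ?_, fun a => rfl⟩
  calc ‖T₀ a‖ ≤ ∫ x, ‖u x * ∑' j, a j * ψ j x‖ := MeasureTheory.norm_integral_le_integral_norm _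
    _ ≤ ∫ x, ‖u x‖ * (C * ‖a‖) := by
        refine MeasureTheory.integral_mono (hi a).norm (hui.mul_const _) fun x => ?_
        rw [norm_mul]
        gcongr
        refine tsum_of_norm_bounded (f := fun j => a j * ψ j x) (g := fun j => ‖a j‖ * C)
          (a := C * ‖a‖) ?_ fun j => ?_
        · rw [← tsum_norm_lp_one, mul_comm]
          exact (summable_norm_lp_one a).hasSum.mul_right C
        · rw [norm_mul]
          gcongr
          exact hC j x
    _ = (∫ x, ‖u x‖) * C * ‖a‖ := by rw [MeasureTheory.integral_mul_const]; ring

/-- Weak negligibility against each test function of an ultradifferentiable class is uniform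
on the unit ball of that class (a Banach–Steinhaus argument). -/
lemma exists_uniform_bound_of_weak {d : ℕ} {M : ℕ → ℝ}
    {f : ℝ → EuclideanSpace ℝ (Fin d) → ℂ}
    (hf : ∀ ε ∈ Set.Ioo (0 : ℝ) 1, Continuous (f ε))
    (hfc : ∀ ε ∈ Set.Ioo (0 : ℝ) 1, HasCompactSupport (f ε))
    {K₁ : Set (EuclideanSpace ℝ (Fin d))} (hK₁ : IsClosed K₁) {N : ℝ → ℝ} (hN : ∀ ε, 0 < N ε)
    (hweak : ∀ φ : EuclideanSpace ℝ (Fin d) → ℂ, ContDiff ℝ (⊤ : ℕ∞) φ → tsupport φ ⊆ K₁ →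
      (∃ B : ℝ, ∀ (x : EuclideanSpace ℝ (Fin d)) (α : Fin d → ℕ),
        ‖mderiv α φ x‖ ≤ B * M (∑ j, α j)) →
      ∃ C : ℝ, 0 < C ∧ ∃ ε₀ ∈ Set.Ioo (0 : ℝ) 1, ∀ ε : ℝ, 0 < ε → ε < ε₀ →
        ‖∫ x, f ε x * φ x‖ ≤ C * N ε) :
    ∃ C : ℝ, 0 < C ∧ ∃ ε₀ ∈ Set.Ioo (0 : ℝ) 1, ∀ ε : ℝ, 0 < ε → ε < ε₀ →
      ∀ φ : EuclideanSpace ℝ (Fin d) → ℂ, ContDiff ℝ (⊤ : ℕ∞) φ → tsupport φ ⊆ K₁ →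
        (∀ (x : EuclideanSpace ℝ (Fin d)) (α : Fin d → ℕ), ‖mderiv α φ x‖ ≤ M (∑ j, α j)) →
        ‖∫ x, f ε x * φ x‖ ≤ C * N ε := by
  by_contra! hcon
  have hlt : ∀ n : ℕ, (1 : ℝ) / (n + 2) ∈ Set.Ioo (0 : ℝ) 1 := fun n =>
    ⟨by positivity, by
      rw [div_lt_one (by positivity)]
      have : (0 : ℝ) ≤ n := n.cast_nonneg
      linarith⟩
  choose ε hε0 hε ψ hψ hsupp hbd hlarge using
    fun n : ℕ => hcon (n + 1) (by positivity) (1 / (n + 2)) (hlt n)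
  have hε1 : ∀ n, ε n ∈ Set.Ioo (0 : ℝ) 1 := fun n => ⟨hε0 n, (hε n).trans (hlt n).2⟩
  have hb : ∀ α : Fin d → ℕ, ∃ C : ℝ, ∀ j x, ‖mderiv α (ψ j) x‖ ≤ C :=
    fun α => ⟨_, fun j x => hbd j x α⟩
  choose T hT using fun n =>
    exists_clm_integral_tsum_mul hψ hb (hf _ (hε1 n)) (hfc _ (hε1 n))
  have hpt : ∀ a : lp (fun _ : ℕ => ℂ) 1, ∃ C : ℝ, ∀ n,
      ‖(((N (ε n))⁻¹ : ℝ) : ℂ) • T n a‖ ≤ C := by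
    intro a
    have ha := summable_norm_lp_one a
    obtain ⟨C, -, ε₀, hε₀, hC⟩ := hweak (fun x => ∑' j, a j * ψ j x)
      (contDiff_tsum_mul hψ hb ha) (by
        refine closure_minimal (fun x hx => ?_) hK₁
        by_contra hxK
        refine hx ?_
        have : ∀ j, ψ j x = 0 := fun j => by
          by_contra h
          exact hxK (hsupp j (subset_closure h))
        simp [this])
      ⟨‖a‖, fun x α => by
        rw [mderiv_tsum_mul hψ hb ha]
        refine tsum_of_norm_bounded (f := fun j => a j * mderiv α (ψ j) x)
          (g := fun j => ‖a j‖ * M (∑ j, α j)) ?_ fun j => ?_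
        · rw [← tsum_norm_lp_one]
          exact ha.hasSum.mul_right _
        · rw [norm_mul]
          gcongr
          exact hbd j x α⟩
    obtain ⟨n₀, hn₀⟩ := exists_nat_one_div_lt hε₀.1
    refine ⟨max C (∑ n ∈ Finset.range n₀, ‖(((N (ε n))⁻¹ : ℝ) : ℂ) • T n a‖), fun n => ?_⟩
    rcases lt_or_ge n n₀ with hn | hn
    · exact le_max_of_le_right (Finset.single_le_sum
        (f := fun n => ‖(((N (ε n))⁻¹ : ℝ) : ℂ) • T n a‖) (fun _ _ => norm_nonneg _)
        (Finset.mem_range.2 hn))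
    · refine le_max_of_le_left ?_
      have hlt' : ε n < ε₀ := by
        refine (hε n).trans (lt_of_le_of_lt ?_ hn₀)
        have : (n₀ : ℝ) ≤ n := by exact_mod_cast hn
        gcongr
        · linarith
      have := hC (ε n) (hε0 n) hlt'
      rw [norm_smul, hT, Complex.norm_real, Real.norm_of_nonneg (inv_nonneg.2 (hN _).le),
        inv_mul_le_iff₀ (hN _)]
      linarith
  obtain ⟨C, hC⟩ := banach_steinhaus (g := fun n => (((N (ε n))⁻¹ : ℝ) : ℂ) • T n)
    fun a => by simpa using hpt a
  obtain ⟨n, hn⟩ := exists_nat_gt C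
  have h1 : T n (lp.single 1 n (1 : ℂ)) = ∫ x, f (ε n) x * ψ n x := by
    rw [hT]
    refine MeasureTheory.integral_congr_ae (Filter.Eventually.of_forall fun x => ?_)
    simp only
    rw [tsum_eq_single n fun j hj => by rw [lp.single_apply_ne _ _ _ hj, zero_mul],
      lp.single_apply_self, one_mul]
  have h2 := ((((N (ε n))⁻¹ : ℝ) : ℂ) • T n).le_of_opNorm_le (hC n) (lp.single 1 n (1 : ℂ))
  rw [smul_apply, h1, lp.norm_single (by simp), norm_one, mul_one, norm_smul,
    Complex.norm_real, Real.norm_of_nonneg (inv_nonneg.2 (hN _).le), inv_mul_le_iff₀ (hN _)] at h2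
  have h3 := hlarge n
  have h4 := hN (ε n)
  nlinarith

lemma norm_mderiv_conj {d : ℕ} (α : Fin d → ℕ) {f : EuclideanSpace ℝ (Fin d) → ℂ}
    (hf : ContDiff ℝ (⊤ : ℕ∞) f) (x : EuclideanSpace ℝ (Fin d)) :
    ‖mderiv α (fun x => (starRingEnd ℂ) (f x)) x‖ = ‖mderiv α f x‖ := by
  have h := mderiv_clm_comp (Complex.conjCLE : ℂ →L[ℝ] ℂ) α hf
  simp only [ContinuousLinearEquiv.coe_coe, Complex.conjCLE_apply] at h
  rw [h, RCLike.norm_conj]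

/-- The `L²` norm of `∂^α u` is obtained by testing `u` against `∂^{2α}` of its conjugate. -/
lemma norm_integral_mul_mderiv_mderiv_conj {d : ℕ} (α : Fin d → ℕ)
    {u : EuclideanSpace ℝ (Fin d) → ℂ}
    (hu : ContDiff ℝ (⊤ : ℕ∞) u) (hc : HasCompactSupport u) :
    ‖∫ x, u x * mderiv α (mderiv α fun x => (starRingEnd ℂ) (u x)) x‖ =
      ∫ x, ‖mderiv α u x‖ ^ 2 := by
  have hconj : ContDiff ℝ (⊤ : ℕ∞) fun x => (starRingEnd ℂ) (u x) :=
    Complex.conjCLE.contDiff.comp hu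
  have h := mderiv_clm_comp (Complex.conjCLE : ℂ →L[ℝ] ℂ) α hu
  simp only [ContinuousLinearEquiv.coe_coe, Complex.conjCLE_apply] at h
  rw [norm_integral_mul_mderiv α hu (hconj.mderiv α) hc, h]
  have : ∀ x, mderiv α u x * (starRingEnd ℂ) (mderiv α u x) =
      ((‖mderiv α u x‖ ^ 2 : ℝ) : ℂ) := fun x => by rw [Complex.mul_conj']; push_cast; rfl
  simp only [this]
  rw [integral_complex_ofReal, Complex.norm_real, Real.norm_of_nonneg]
  exact MeasureTheory.integral_nonneg fun x => by positivity

lemma sum_add_single {d : ℕ} (α : Fin d → ℕ) (i : Fin d) :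
    ∑ j, (α + Pi.single i 1 : Fin d → ℕ) j = ∑ j, α j + 1 := by
  simp [Finset.sum_add_distrib]

/-- The supremum of `∂^α u` is controlled once the derivatives of `u` satisfy an
ultradifferentiable bound `A` and `u` is weakly bounded by `η` on the unit ball of the class. -/
lemma norm_mderiv_pow_le {d : ℕ} {Mp : ℕ → ℝ} (hMpos : ∀ p, 0 < Mp p)
    {c0 H : ℝ} (hc0 : 1 ≤ c0) (hH : 1 ≤ H) (hM2 : CondM2 Mp c0 H)
    {K₁ : Set (EuclideanSpace ℝ (Fin d))} {u : EuclideanSpace ℝ (Fin d) → ℂ}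
    (hu : ContDiff ℝ (⊤ : ℕ∞) u) (hc : HasCompactSupport u) (huK : tsupport u ⊆ K₁)
    {rt q A η : ℝ} (hq : 0 < q) (hqrt : q ≤ rt) (hA : 0 < A)
    (hder : ∀ x (α : Fin d → ℕ),
      ‖mderiv α u x‖ ≤ A * ((q / H ^ 2) ^ (∑ j, α j) * Mp (∑ j, α j)))
    (hweak : ∀ φ : EuclideanSpace ℝ (Fin d) → ℂ, ContDiff ℝ (⊤ : ℕ∞) φ → tsupport φ ⊆ K₁ →
      (∀ (x : EuclideanSpace ℝ (Fin d)) (α : Fin d → ℕ),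
        ‖mderiv α φ x‖ ≤ rt ^ (∑ j, α j) * Mp (∑ j, α j)) → ‖∫ x, u x * φ x‖ ≤ η)
    (x : EuclideanSpace ℝ (Fin d)) (α : Fin d → ℕ) :
    ‖mderiv α u x‖ ^ (d + 2) *
        MeasureTheory.volume.real (Metric.ball (0 : EuclideanSpace ℝ (Fin d)) 1) ≤
      2 ^ (d + 2) * ((d + 1) * (q * c0 * Mp 1)) ^ d * c0 ^ 2 * A ^ (d + 1) * η *
        (q ^ (∑ j, α j) * Mp (∑ j, α j)) ^ (d + 2) := by
  set n := ∑ j, α j with hn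
  set h := q / H ^ 2 with hh
  have hH0 : 0 < H := by linarith
  have hh0 : 0 < h := by positivity
  have hhH2 : h * H ^ 2 = q := by rw [hh]; field_simp
  have hhH : h * H ≤ q := by
    rw [← hhH2]; gcongr; nlinarith
  have hn0 := hMpos n
  have h10 := hMpos 1
  have hL : ∀ x, ‖fderiv ℝ (mderiv α u) x‖ ≤
      (d + 1) * (q * c0 * Mp 1) * A * (q ^ n * Mp n) := by
    intro x
    have h1 : ∀ i, ‖pderiv1 i (mderiv α u) x‖ ≤ (q * c0 * Mp 1) * A * (q ^ n * Mp n) := by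
      intro i
      rw [pderiv1_mderiv α i hu]
      refine (hder x _).trans ?_
      rw [sum_add_single, ← hn]
      calc A * (h ^ (n + 1) * Mp (n + 1))
          ≤ A * (h ^ (n + 1) * (c0 * H ^ (n + 1) * Mp n * Mp 1)) := by
            gcongr; exact hM2 n 1
        _ = c0 * Mp 1 * A * Mp n * (h * H) ^ (n + 1) := by rw [mul_pow]; ring
        _ ≤ c0 * Mp 1 * A * Mp n * q ^ (n + 1) := by gcongr
        _ = _ := by ring
    refine (norm_fderiv_le_sum_pderiv1 _ x).trans ((Finset.sum_le_sum fun i _ => h1 i).trans ?_)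
    rw [Finset.sum_const, Finset.card_univ, Fintype.card_fin, nsmul_eq_mul]
    have : 0 ≤ (q * c0 * Mp 1) * A * (q ^ n * Mp n) := by positivity
    nlinarith
  set B := A * c0 ^ 2 * (q ^ n * Mp n) ^ 2 with hB
  have hB0 : 0 < B := by positivity
  have hconj : ContDiff ℝ (⊤ : ℕ∞) fun x => (starRingEnd ℂ) (u x) :=
    Complex.conjCLE.contDiff.comp hu
  have hL2 : ∫ y, ‖mderiv α u y‖ ^ 2 ≤ B * η := by
    set φ := mderiv α (mderiv α fun x => (starRingEnd ℂ) (u x)) with hφ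
    have hφs : ContDiff ℝ (⊤ : ℕ∞) φ := (hconj.mderiv α).mderiv α
    have hφK : tsupport φ ⊆ K₁ := by
      refine (tsupport_mderiv_subset _ _).trans ((tsupport_mderiv_subset _ _).trans ?_)
      have : (Function.support fun x => (starRingEnd ℂ) (u x)) ⊆ Function.support u :=
        fun x hx hx0 => hx (by simp [hx0])
      exact (closure_mono this).trans huK
    have hscale : ∀ β x, mderiv β (fun x => (B⁻¹ : ℝ) • φ x) x = (B⁻¹ : ℝ) • mderiv β φ x :=
      fun β x => congrFun (mderiv_clm_comp ((B⁻¹ : ℝ) • ContinuousLinearMap.id ℝ ℂ) β hφs) x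
    have hφb : ∀ (x : EuclideanSpace ℝ (Fin d)) (β : Fin d → ℕ),
        ‖mderiv β (fun x => (B⁻¹ : ℝ) • φ x) x‖ ≤ rt ^ (∑ j, β j) * Mp (∑ j, β j) := by
      intro x β
      rw [hscale, norm_smul, Real.norm_of_nonneg (inv_nonneg.2 hB0.le), inv_mul_le_iff₀ hB0, hφ,
        mderiv_mderiv _ _ (hconj.mderiv α), mderiv_mderiv _ _ hconj, norm_mderiv_conj _ hu]
      refine (hder x _).trans ?_
      have hsum : ∑ j, (β + α + α) j = (n + n) + ∑ j, β j := by
        simp only [Pi.add_apply, Finset.sum_add_distrib, hn]; ring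
      rw [hsum]
      set b := ∑ j, β j
      have hb0 := hMpos b
      calc A * (h ^ (n + n + b) * Mp (n + n + b))
          ≤ A * (h ^ (n + n + b) * (c0 * H ^ (n + n + b) * Mp (n + n) * Mp b)) := by
            gcongr; exact hM2 (n + n) b
        _ ≤ A * (h ^ (n + n + b) *
              (c0 * H ^ (n + n + b) * (c0 * H ^ (n + n) * Mp n * Mp n) * Mp b)) := by
            gcongr; exact hM2 n n
        _ = A * c0 ^ 2 * ((h * H ^ 2) ^ n * Mp n) ^ 2 * ((h * H) ^ b * Mp b) := by
            simp only [mul_pow, pow_add]; ring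
        _ ≤ A * c0 ^ 2 * (q ^ n * Mp n) ^ 2 * (rt ^ b * Mp b) := by
            rw [hhH2]; gcongr; exact hhH.trans hqrt
    have hsub : (Function.support fun x => (B⁻¹ : ℝ) • φ x) ⊆ Function.support φ :=
      fun x hx hx0 => hx (by simp [hx0])
    have h2 := hweak (fun x => (B⁻¹ : ℝ) • φ x) (hφs.const_smul _)
      ((closure_mono hsub).trans hφK) hφb
    have h3 : ∫ x, u x * ((B⁻¹ : ℝ) • φ x) = (B⁻¹ : ℝ) • ∫ x, u x * φ x := by
      rw [← MeasureTheory.integral_smul]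
      refine MeasureTheory.integral_congr_ae (Filter.Eventually.of_forall fun x => ?_)
      simp only [mul_smul_comm]
    rw [h3, norm_smul, Real.norm_of_nonneg (inv_nonneg.2 hB0.le), inv_mul_le_iff₀ hB0, hφ,
      norm_integral_mul_mderiv_mderiv_conj α hu hc] at h2
    exact h2
  have hcα : HasCompactSupport (mderiv α u) :=
    hc.mono' (subset_closure.trans (tsupport_mderiv_subset α u))
  refine (norm_pow_le_of_norm_fderiv_le ((hu.mderiv α).differentiable (by simp)) hcα
    (L := (d + 1) * (q * c0 * Mp 1) * A * (q ^ n * Mp n)) (by positivity) hL x).trans ?_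
  calc _ ≤ 2 ^ (d + 2) * ((d + 1) * (q * c0 * Mp 1) * A * (q ^ n * Mp n)) ^ d * (B * η) := by
        gcongr
    _ = _ := by
        rw [hB, mul_pow _ (q ^ n * Mp n), mul_pow _ A, pow_add _ d 2, pow_add _ d 2, pow_succ A]
        ring

/-- If the associated function is infinite somewhere, moderateness and negligibility coincide. -/
lemma NegligibleB.of_not_bddAbove {d : ℕ} {Mp : ℕ → ℝ} (hMpos : ∀ p, 0 < Mp p)
    {ρ : ℝ} (hρ : 0 < ρ)
    (hb : ¬ BddAbove (Set.range fun p : ℕ => logPlus (ρ ^ p / Mp p)))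
    {f : ℝ → EuclideanSpace ℝ (Fin d) → ℂ} (hmod : ModerateB Mp f) : NegligibleB Mp f := by
  have hzero : ∀ σ, ρ ≤ σ → assocM Mp σ = 0 := by
    intro σ hσ
    refine Real.iSup_of_not_bddAbove fun hσb => hb ?_
    obtain ⟨B, hB⟩ := hσb
    refine ⟨B, ?_⟩
    rintro _ ⟨p, rfl⟩
    refine le_trans ?_ (hB ⟨p, rfl⟩)
    have := hMpos p
    refine max_le_max (Real.log_le_log (by positivity) ?_) le_rfl
    gcongr
  intro K' hK' h hh k hk
  obtain ⟨k', hk', C, hC, ε₀, hε₀, hbound⟩ := hmod K' hK' h hh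
  refine ⟨C, hC, min ε₀ (min (k / ρ) (k' / ρ)), ⟨?_, ?_⟩, fun ε hε hlt x hx α => ?_⟩
  · exact lt_min hε₀.1 (lt_min (by positivity) (by positivity))
  · exact (min_le_left _ _).trans_lt hε₀.2
  · rw [lt_min_iff, lt_min_iff, lt_div_iff₀ hρ, lt_div_iff₀ hρ] at hlt
    have h1 := hbound ε hε hlt.1 x hx α
    rw [hzero (k' / ε) (by rw [le_div_iff₀ hε]; linarith)] at h1
    rw [hzero (k / ε) (by rw [le_div_iff₀ hε]; linarith)]
    simpa using h1

theorem stmt13 {d : ℕ} (Mp : ℕ → ℝ) (hMpos : ∀ p, 0 < Mp p) (hM0 : Mp 0 = 1)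
    (hM1 : CondM1 Mp) (hM2 : CondM2' Mp) (hM3 : CondM3 Mp)
    (K : Set (EuclideanSpace ℝ (Fin d))) (hK : IsCompact K)
    (f : ℝ → EuclideanSpace ℝ (Fin d) → ℂ)
    (hsmooth : ∀ ε ∈ Set.Ioo (0 : ℝ) 1, ContDiff ℝ (⊤ : ℕ∞) (f ε))
    (hsupp : ∀ ε ∈ Set.Ioo (0 : ℝ) 1, tsupport (f ε) ⊆ K)
    (hmod : ModerateB Mp f)
    (hweak : ∃ rt : ℝ, 0 < rt ∧ ∃ K₁ : Set (EuclideanSpace ℝ (Fin d)),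
      IsCompact K₁ ∧ K ⊆ interior K₁ ∧
      ∀ φ : EuclideanSpace ℝ (Fin d) → ℂ, ContDiff ℝ (⊤ : ℕ∞) φ → tsupport φ ⊆ K₁ →
        (∃ B : ℝ, ∀ (x : EuclideanSpace ℝ (Fin d)) (α : Fin d → ℕ),
          ‖mderiv α φ x‖ ≤ B * rt ^ (∑ j, α j) * Mp (∑ j, α j)) →
        ∀ k : ℝ, 0 < k → ∃ C : ℝ, 0 < C ∧ ∃ ε₀ ∈ Set.Ioo (0 : ℝ) 1,
          ∀ ε : ℝ, 0 < ε → ε < ε₀ →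
            ‖∫ x : EuclideanSpace ℝ (Fin d), f ε x * φ x‖ ≤
              C * Real.exp (-assocM Mp (k / ε))) :
    NegligibleB Mp f := by
  obtain ⟨c0, H, hc0, hH, hM2⟩ := hM2
  obtain ⟨rt, hrt, K₁, hK₁, hKK₁, hweak⟩ := hweak
  by_cases hb : ∀ ρ : ℝ, 0 < ρ → BddAbove (Set.range fun p : ℕ => logPlus (ρ ^ p / Mp p))
  swap
  · push Not at hb
    obtain ⟨ρ, hρ, hb⟩ := hb
    exact NegligibleB.of_not_bddAbove hMpos hρ hb hmod
  intro K' _ h hh k hk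
  have hH0 : 0 < H := by linarith
  set q := min h rt with hq
  have hq0 : 0 < q := lt_min hh hrt
  obtain ⟨k', hk', C₁, hC₁, ε₁, hε₁, hbound⟩ := hmod K hK (q / H ^ 2) (by positivity)
  obtain ⟨C₂, s, hs, hM⟩ :=
    exists_nat_mul_assocM_le hMpos hM0 hc0 hH hM2 hb (d + 1 + (d + 2))
  set κ := max k k' with hκ
  have hκ0 : 0 < κ := lt_max_of_lt_left hk
  have hc : ∀ ε ∈ Set.Ioo (0 : ℝ) 1, HasCompactSupport (f ε) := fun ε hε =>
    hK.of_isClosed_subset (isClosed_tsupport _) (hsupp ε hε)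
  obtain ⟨C₃, hC₃, ε₂, hε₂, hunif⟩ := exists_uniform_bound_of_weak
    (M := fun p => rt ^ p * Mp p) (fun ε hε => (hsmooth ε hε).continuous) hc
    hK₁.isClosed (N := fun ε => Real.exp (-assocM Mp (s * κ / ε))) (fun ε => Real.exp_pos _)
    (fun φ hφ hφK ⟨B, hB⟩ => hweak φ hφ hφK
      ⟨B, fun x α => by rw [mul_assoc]; exact hB x α⟩ (s * κ) (by positivity))
  set v := MeasureTheory.volume.real (Metric.ball (0 : EuclideanSpace ℝ (Fin d)) 1) with hv
  have hv0 : 0 < v := ENNReal.toReal_pos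
    (Metric.measure_ball_pos MeasureTheory.volume 0 one_pos).ne' (by finiteness)
  have h10 := hMpos 1
  set D := 2 ^ (d + 2) * ((d + 1) * (q * c0 * Mp 1)) ^ d * c0 ^ 2 * C₁ ^ (d + 1) * C₃ *
    Real.exp C₂ / v with hD
  have hD0 : 0 < D := by positivity
  refine ⟨max D 1, by positivity, min ε₁ ε₂, ⟨lt_min hε₁.1 hε₂.1,
    (min_le_left _ _).trans_lt hε₁.2⟩, fun ε hε hlt x _ α => ?_⟩
  rw [lt_min_iff] at hlt
  have hε1 : ε ∈ Set.Ioo (0 : ℝ) 1 := ⟨hε, hlt.1.trans hε₁.2⟩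
  set A := C₁ * Real.exp (assocM Mp (k' / ε)) with hA
  have hder : ∀ x (α : Fin d → ℕ),
      ‖mderiv α (f ε) x‖ ≤ A * ((q / H ^ 2) ^ (∑ j, α j) * Mp (∑ j, α j)) := by
    intro x α
    have hp := hMpos (∑ j, α j)
    by_cases hx : x ∈ K
    · rw [← div_le_iff₀ (by positivity)]
      exact hbound ε hε hlt.1 x hx α
    · have : mderiv α (f ε) x = 0 := by
        by_contra h0
        exact hx (hsupp ε hε1 (tsupport_mderiv_subset α _ (subset_closure h0)))
      rw [this, norm_zero]
      positivity
  have key := norm_mderiv_pow_le hMpos hc0 hH hM2 (hsmooth ε hε1) (hc ε hε1)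
    ((hsupp ε hε1).trans (hKK₁.trans interior_subset)) hq0 (min_le_right h rt)
    (by positivity) hder (hunif ε hε hlt.2) x α
  set n := ∑ j, α j with hn
  have hn0 := hMpos n
  rw [div_le_iff₀ (by positivity)]
  have hexp : Real.exp (assocM Mp (k' / ε)) ^ (d + 1) * Real.exp (-assocM Mp (s * κ / ε)) ≤
      Real.exp C₂ * Real.exp (-assocM Mp (k / ε)) ^ (d + 2) := by
    rw [← Real.exp_nat_mul, ← Real.exp_nat_mul, ← Real.exp_add, ← Real.exp_add, Real.exp_le_exp]
    have hκε : 0 < κ / ε := by positivity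
    have h1 := hM (κ / ε) hκε
    rw [← mul_div_assoc] at h1
    have h2 := assocM_mono hMpos hM0 (ρ := k / ε) (σ := κ / ε) (by positivity)
      (by gcongr; exact le_max_left _ _) (hb _ hκε)
    have h3 := assocM_mono hMpos hM0 (ρ := k' / ε) (σ := κ / ε) (by positivity)
      (by gcongr; exact le_max_right _ _) (hb _ hκε)
    have h4 := mul_le_mul_of_nonneg_left h2 (by positivity : (0 : ℝ) ≤ d + 2)
    have h5 := mul_le_mul_of_nonneg_left h3 (by positivity : (0 : ℝ) ≤ d + 1)
    push_cast at h1 ⊢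
    linarith
  refine le_of_pow_le_pow_left₀ (n := d + 2) (by omega) (by positivity) ?_
  rw [← le_div_iff₀ hv0] at key
  calc ‖mderiv α (f ε) x‖ ^ (d + 2) ≤ _ := key
    _ = 2 ^ (d + 2) * ((d + 1) * (q * c0 * Mp 1)) ^ d * c0 ^ 2 * C₁ ^ (d + 1) * C₃ / v *
          (Real.exp (assocM Mp (k' / ε)) ^ (d + 1) * Real.exp (-assocM Mp (s * κ / ε))) *
          (q ^ n * Mp n) ^ (d + 2) := by rw [hA, mul_pow C₁]; ring
    _ ≤ 2 ^ (d + 2) * ((d + 1) * (q * c0 * Mp 1)) ^ d * c0 ^ 2 * C₁ ^ (d + 1) * C₃ / v *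
          (Real.exp C₂ * Real.exp (-assocM Mp (k / ε)) ^ (d + 2)) *
          (h ^ n * Mp n) ^ (d + 2) := by
        gcongr
        exact min_le_left _ _
    _ = D * (Real.exp (-assocM Mp (k / ε)) * (h ^ n * Mp n)) ^ (d + 2) := by
        rw [hD, mul_pow (Real.exp _)]; ring
    _ ≤ (max D 1) ^ (d + 2) * (Real.exp (-assocM Mp (k / ε)) * (h ^ n * Mp n)) ^ (d + 2) := by
        gcongr
        exact (le_max_left D 1).trans (le_self_pow₀ (le_max_right D 1) (by omega))
    _ = _ := by rw [← mul_pow, mul_assoc]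
end
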